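/- Fix c > 1 and ε ≥ 0, set c* := c/(c−1) and ρ_{c,ε}(x) := (1 + c(c−1)ε)^{c*/c} ((x)_+)^{c*}, and define the Cressie–Read DRO criterion DRO_{c,ε}(L) := inf_{θ ∈ ℝ} [θ + (E[ρ_{c,ε}(L − θ)])^{1/c*}]. Then every error-probability minimizer is optimal for this criterion under the zero-one loss: Herr ⊂ argmin_{h ∈ H} DRO_{c,ε}(L01(h)). -/

import Mathlib

open MeasureTheory Real Set
open scoped Classical

/-- Expectation of a function of a shifted indicator variable. -/
lemma integral_comp_ite_sub {Ω : Type*} [MeasurableSpace Ω] (μ : Measure Ω)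
    [IsProbabilityMeasure μ] {p : Ω → Prop} [DecidablePred p]
    (hp : MeasurableSet {ω | p ω}) (ρ : ℝ → ℝ) (θ : ℝ) :
    ∫ ω, ρ ((if p ω then 1 else 0) - θ) ∂μ
      = (μ {ω | p ω}).toReal * (ρ (1 - θ) - ρ (-θ)) + ρ (-θ) := by
  have h : (fun ω => ρ ((if p ω then 1 else 0) - θ))
      = fun ω => {ω | p ω}.indicator (fun _ => ρ (1 - θ) - ρ (-θ)) ω + ρ (-θ) := by
    funext ω
    by_cases hω : p ω <;> simp [hω]
  rw [h, integral_add ((integrable_const _).indicator hp) (integrable_const _),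
    integral_indicator_const _ hp]
  simp [Measure.real]

/-- Criterion collapse for Cressie–Read DRO criteria: for `c > 1` and `ε ≥ 0`,
with `c* = c/(c-1)` and `ρ_{c,ε}(x) = (1 + c(c-1)ε)^(c*/c) ((x)_+)^(c*)`,
error-probability minimizers in `H` are optimal for
`DRO_{c,ε}(L) = inf_θ [θ + (E[ρ_{c,ε}(L - θ)])^(1/c*)]` under the zero-one loss. -/
theorem cressie_read_dro_collapse_zero_one
    {Ω 𝒳 𝒴 : Type*} [MeasurableSpace Ω]
    (μ : Measure Ω) [IsProbabilityMeasure μ]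
    (X : Ω → 𝒳) (Y : Ω → 𝒴)
    (H : Set (𝒳 → 𝒴))
    (hmeas : ∀ h ∈ H, MeasurableSet {ω | h (X ω) ≠ Y ω})
    (c ε : ℝ) (hc : 1 < c) (hε : 0 ≤ ε)
    (L01 : (𝒳 → 𝒴) → Ω → ℝ)
    (hL01 : ∀ h : 𝒳 → 𝒴, ∀ ω : Ω, L01 h ω = if h (X ω) ≠ Y ω then 1 else 0)
    (err : (𝒳 → 𝒴) → ℝ)
    (herr : ∀ h : 𝒳 → 𝒴, err h = (μ {ω | h (X ω) ≠ Y ω}).toReal)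
    (ρ : ℝ → ℝ)
    (hρ : ∀ x : ℝ,
      ρ x = (1 + c * (c - 1) * ε) ^ ((c / (c - 1)) / c) * (max 0 x) ^ (c / (c - 1)))
    (DRO : (Ω → ℝ) → ℝ)
    (hDRO : ∀ L : Ω → ℝ,
      DRO L = ⨅ θ : ℝ, θ + (∫ ω, ρ (L ω - θ) ∂μ) ^ (1 / (c / (c - 1))))
    (h₀ : 𝒳 → 𝒴) (h₀H : h₀ ∈ H) (h₀opt : ∀ h ∈ H, err h₀ ≤ err h) :
    ∀ h ∈ H, DRO (L01 h₀) ≤ DRO (L01 h) := by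
  intro h hH
  set s : ℝ := c / (c - 1) with hs
  have hc1 : 0 < c - 1 := by linarith
  have hs0 : 0 < s := by positivity
  have hK : 1 ≤ (1 + c * (c - 1) * ε) ^ (s / c) := by
    refine Real.one_le_rpow ?_ (by positivity)
    have : 0 ≤ c * (c - 1) * ε := by positivity
    linarith
  have hρ_nonneg : ∀ x, 0 ≤ ρ x := fun x => by
    rw [hρ]
    have : 0 ≤ max 0 x := le_max_left _ _
    positivity
  have hρ_mono : Monotone ρ := fun x y hxy => by
    rw [hρ, hρ]
    have : 0 ≤ max 0 x := le_max_left _ _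
    gcongr
  have hint : ∀ g ∈ H, ∀ θ, ∫ ω, ρ (L01 g ω - θ) ∂μ
      = err g * (ρ (1 - θ) - ρ (-θ)) + ρ (-θ) := fun g hg θ => by
    simp only [hL01, herr]
    exact integral_comp_ite_sub μ (hmeas g hg) ρ θ
  have herr_nonneg : 0 ≤ err h₀ := by
    rw [herr]
    positivity
  have hdiff : ∀ θ, 0 ≤ ρ (1 - θ) - ρ (-θ) := fun θ =>
    sub_nonneg.2 (hρ_mono (by linarith))
  have hbase : ∀ θ, ρ (-θ) ≤ ∫ ω, ρ (L01 h₀ ω - θ) ∂μ := fun θ => by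
    rw [hint h₀ h₀H]
    linarith [mul_nonneg herr_nonneg (hdiff θ)]
  rw [hDRO, hDRO]
  refine ciInf_mono ⟨0, ?_⟩ fun θ => ?_
  · rintro _ ⟨θ, rfl⟩
    have hmax : max 0 (-θ) ^ s ≤ ∫ ω, ρ (L01 h₀ ω - θ) ∂μ := by
      refine le_trans ?_ (hbase θ)
      rw [hρ]
      exact le_mul_of_one_le_left (Real.rpow_nonneg (le_max_left _ _) _) hK
    have hroot : max 0 (-θ) ≤ (∫ ω, ρ (L01 h₀ ω - θ) ∂μ) ^ (1 / s) := by
      have := Real.rpow_le_rpow (Real.rpow_nonneg (le_max_left _ _) _) hmax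
        (one_div_pos.2 hs0).le
      rwa [one_div, Real.rpow_rpow_inv (le_max_left _ _) hs0.ne', ← one_div] at this
    change 0 ≤ θ + (∫ ω, ρ (L01 h₀ ω - θ) ∂μ) ^ (1 / s)
    linarith [le_max_right 0 (-θ)]
  · have hle : ∫ ω, ρ (L01 h₀ ω - θ) ∂μ ≤ ∫ ω, ρ (L01 h ω - θ) ∂μ := by
      rw [hint h₀ h₀H, hint h hH]
      have := mul_le_mul_of_nonneg_right (h₀opt h hH) (hdiff θ)
      linarith
    have := Real.rpow_le_rpow ((hρ_nonneg _).trans (hbase θ)) hle (one_div_pos.2 hs0).le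
    linarith
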